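/- Suppose a Boolean algebra B has a closed unbounded set C ⊆ [B]^ω of countable regular subalgebras that is closed under the operation (A₁, A₂) ↦ ⟨A₁ ∪ A₂⟩ (the subalgebra generated by the union). Then for every family S ⊆ C, the subalgebra ⟨⋃S⟩ of B generated by ⋃S is a regular subalgebra of B. -/

import Mathlib

def Subalg {B : Type*} [BooleanAlgebra B] (A : Set B) : Prop :=
  ⊥ ∈ A ∧ ⊤ ∈ A ∧ (∀ x ∈ A, ∀ y ∈ A, x ⊔ y ∈ A) ∧ (∀ x ∈ A, xᶜ ∈ A)

def MaxACIn {B : Type*} [BooleanAlgebra B] (W A : Set B) : Prop :=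
  W ⊆ A ∧ ⊥ ∉ W ∧ W.Pairwise (fun x y => x ⊓ y = ⊥) ∧
    ∀ a ∈ A, a ≠ ⊥ → ∃ w ∈ W, a ⊓ w ≠ ⊥

/-- `X` is a regular subalgebra of `A`: every maximal antichain of `X` is maximal in `A`. -/
def RegIn {B : Type*} [BooleanAlgebra B] (X A : Set B) : Prop :=
  ∀ W : Set B, MaxACIn W X → MaxACIn W A

/-- `C` is a closed unbounded family of countable subsets of `A`. -/
def ClubIn {B : Type*} (A : Set B) (C : Set (Set B)) : Prop :=
  (∀ x ∈ C, x ⊆ A ∧ x.Countable) ∧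
  (∀ f : ℕ → Set B, (∀ n, f n ∈ C) → Monotone f → (⋃ n, f n) ∈ C) ∧
  (∀ x : Set B, x ⊆ A → x.Countable → ∃ y ∈ C, x ⊆ y)

/-- The subalgebra of the ambient algebra generated by `X`. -/
def genAlg {B : Type*} [BooleanAlgebra B] (X : Set B) : Set B :=
  ⋂₀ {A : Set B | Subalg A ∧ X ⊆ A}

theorem genAlg_subalg {B : Type*} [BooleanAlgebra B] (X : Set B) : Subalg (genAlg X) := by
  refine ⟨?_, ?_, ?_, ?_⟩
  · rintro A ⟨hA, -⟩; exact hA.1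
  · rintro A ⟨hA, -⟩; exact hA.2.1
  · intro x hx y hy A hA
    exact hA.1.2.2.1 x (hx A hA) y (hy A hA)
  · intro x hx A hA
    exact hA.1.2.2.2 x (hx A hA)

theorem subset_genAlg {B : Type*} [BooleanAlgebra B] (X : Set B) : X ⊆ genAlg X :=
  fun _ hx _ hA => hA.2 hx

theorem genAlg_min {B : Type*} [BooleanAlgebra B] {X A : Set B} (hA : Subalg A) (h : X ⊆ A) :
    genAlg X ⊆ A := fun _ hx => hx A ⟨hA, h⟩

/-- Lemma 3.6: if `B` has a closed unbounded set `C` of countable regular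
subalgebras closed under `(A₁, A₂) ↦ ⟨A₁ ∪ A₂⟩`, then for every `S ⊆ C` the
subalgebra generated by `⋃ S` is a regular subalgebra of `B`. -/
theorem generated_union_regular {B : Type*} [BooleanAlgebra B] (C : Set (Set B))
    (hclub : ClubIn Set.univ C)
    (hsub : ∀ A ∈ C, Subalg A ∧ RegIn A Set.univ)
    (hpair : ∀ A₁ ∈ C, ∀ A₂ ∈ C, genAlg (A₁ ∪ A₂) ∈ C) :
    ∀ S ⊆ C, RegIn (genAlg (⋃₀ S)) Set.univ := by
  intro S hS W hW
  obtain ⟨hWD, hW0, hWp, hWm⟩ := hW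
  refine ⟨Set.subset_univ _, hW0, hWp, ?_⟩
  rcases S.eq_empty_or_nonempty with rfl | ⟨A₀, hA₀⟩
  · intro a _ ha
    have htop : (⊤ : B) ≠ ⊥ := fun h => ha (le_bot_iff.1 (h ▸ le_top))
    obtain ⟨w, hw, hne⟩ := hWm ⊤ (genAlg_subalg _).2.1 htop
    have hs : Subalg ({⊥, ⊤} : Set B) := by
      refine ⟨by simp, by simp, ?_, ?_⟩
      · rintro x (rfl | rfl) y (rfl | rfl) <;> simp
      · rintro x (rfl | rfl) <;> simp
    have h2 : w ∈ ({⊥, ⊤} : Set B) := genAlg_min hs (by simp) (hWD hw)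
    rcases h2 with rfl | h2
    · exact absurd hw hW0
    · rw [Set.mem_singleton_iff] at h2
      subst h2
      exact ⟨_, hw, by simpa using ha⟩
  set D := genAlg (⋃₀ S) with hD
  have hDs : Subalg D := genAlg_subalg _
  let F : Set (Set B) := {A | A ∈ C ∧ A ⊆ D}
  have hSF : ∀ A ∈ S, A ∈ F := fun A hA =>
    ⟨hS hA, fun x hx => subset_genAlg _ (Set.mem_sUnion_of_mem hx hA)⟩
  have hFp : ∀ A₁ ∈ F, ∀ A₂ ∈ F, genAlg (A₁ ∪ A₂) ∈ F := fun A₁ h1 A₂ h2 =>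
    ⟨hpair _ h1.1 _ h2.1, genAlg_min hDs (Set.union_subset h1.2 h2.2)⟩
  have hFu : ∀ f : ℕ → Set B, (∀ n, f n ∈ F) → Monotone f → (⋃ n, f n) ∈ F := fun f hf hm =>
    ⟨hclub.2.1 f (fun n => (hf n).1) hm, Set.iUnion_subset fun n => (hf n).2⟩
  have hl : ∀ A₁ A₂ : Set B, A₁ ⊆ genAlg (A₁ ∪ A₂) := fun A₁ A₂ =>
    Set.subset_union_left.trans (subset_genAlg _)
  have hr : ∀ A₁ A₂ : Set B, A₂ ⊆ genAlg (A₁ ∪ A₂) := fun A₁ A₂ =>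
    Set.subset_union_right.trans (subset_genAlg _)
  have hDF : D ⊆ ⋃₀ F := by
    apply genAlg_min
    · refine ⟨⟨A₀, hSF _ hA₀, (hsub _ (hS hA₀)).1.1⟩, ⟨A₀, hSF _ hA₀, (hsub _ (hS hA₀)).1.2.1⟩,
        ?_, ?_⟩
      · rintro x ⟨A₁, h1, hx⟩ y ⟨A₂, h2, hy⟩
        exact ⟨_, hFp _ h1 _ h2, (genAlg_subalg _).2.2.1 x (hl _ _ hx) y (hr _ _ hy)⟩
      · rintro x ⟨A₁, h1, hx⟩
        exact ⟨A₁, h1, (hsub _ h1.1).1.2.2.2 x hx⟩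
    · exact fun x ⟨A, hA, hx⟩ => ⟨A, hSF A hA, hx⟩
  have step : ∀ A : F, ∃ A' : F, A.1 ⊆ A'.1 ∧
      ∀ e ∈ A.1, e ≠ ⊥ → ∃ w ∈ W ∩ A'.1, e ⊓ w ≠ ⊥ := by
    rintro ⟨A, hA⟩
    obtain ⟨e, he⟩ := (hclub.1 A hA.1).2.exists_eq_range ⟨⊥, (hsub _ hA.1).1.1⟩
    have h1 : ∀ k, ∃ G : F, e k ≠ ⊥ → ∃ w ∈ W ∩ G.1, e k ⊓ w ≠ ⊥ := by
      intro k
      by_cases hk : e k = ⊥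
      · exact ⟨⟨A, hA⟩, fun h => absurd hk h⟩
      · obtain ⟨w, hw, hne⟩ := hWm (e k) (hA.2 (he ▸ Set.mem_range_self k)) hk
        obtain ⟨G, hG, hwG⟩ := hDF (hWD hw)
        exact ⟨⟨G, hG⟩, fun _ => ⟨w, ⟨hw, hwG⟩, hne⟩⟩
    choose G hG using h1
    let f : ℕ → F := fun n => Nat.rec ⟨A, hA⟩
      (fun k P => ⟨genAlg (P.1 ∪ (G k).1), hFp _ P.2 _ (G k).2⟩) n
    have hm : Monotone (fun n => (f n).1) := monotone_nat_of_le_succ fun n => hl _ _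
    refine ⟨⟨⋃ n, (f n).1, hFu _ (fun n => (f n).2) hm⟩,
      Set.subset_iUnion (fun n => (f n).1) 0, ?_⟩
    intro x hx hx0
    change x ∈ A at hx
    rw [he] at hx
    obtain ⟨k, rfl⟩ := hx
    obtain ⟨w, hw, hne⟩ := hG k hx0
    refine ⟨w, ⟨hw.1, ?_⟩, hne⟩
    exact Set.mem_iUnion.2 ⟨k + 1, hr (f k).1 (G k).1 hw.2⟩
  choose nx hnx1 hnx2 using step
  let f : ℕ → F := fun n => Nat.rec ⟨A₀, hSF _ hA₀⟩ (fun _ P => nx P) n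
  have hm : Monotone (fun n => (f n).1) := monotone_nat_of_le_succ fun n => hnx1 (f n)
  have hE := hFu _ (fun n => (f n).2) hm
  have hmax : MaxACIn (W ∩ ⋃ n, (f n).1) (⋃ n, (f n).1) := by
    refine ⟨Set.inter_subset_right, fun h => hW0 h.1, hWp.mono Set.inter_subset_left, ?_⟩
    intro a ha ha0
    obtain ⟨n, hn⟩ := Set.mem_iUnion.1 ha
    obtain ⟨w, hw, hne⟩ := hnx2 (f n) a hn ha0
    exact ⟨w, ⟨hw.1, Set.mem_iUnion.2 ⟨n + 1, hw.2⟩⟩, hne⟩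
  intro a ha ha0
  obtain ⟨w, hw, hne⟩ := ((hsub _ hE.1).2 _ hmax).2.2.2 a ha ha0
  exact ⟨w, hw.1, hne⟩
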